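/- arXiv:2401.03288 — 3 statements merged into one kernel-verified Lean document; each statement's English description precedes it below -/
import Mathlib

section
/- Let A be a commutative integral domain, r ≥ 1 an integer, and X_1, …, X_r ∈ A nonzero elements such that X_i − X_j is a unit of A whenever i ≠ j. Let Q(X) = ∏_{i=1}^r (X − X_i) ∈ A[X] and for each i let Q_i(X) = ∏_{j≠i} (X − X_j), so Q(X) = (X − X_i)·Q_i(X). For ℓ ∈ {0, …, r−1} set γ_{iℓ} = X_i^ℓ · (∏_{j≠i} (X_i − X_j))^{−1} ∈ A. Then the polynomial X^{2ℓ} − ∑_{i=1}^r γ_{iℓ}² · Q_i(X)² lies in the ideal 2·A[X] and has degree at most 2r − 1. -/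
open Polynomial Finset

theorem two_dvd_sq_sum_sub_sum_sq {R ι : Type*} [CommRing R] (s : Finset ι) (f : ι → R) :
    (2 : R) ∣ (∑ i ∈ s, f i) ^ 2 - ∑ i ∈ s, f i ^ 2 := by
  classical
  induction s using Finset.induction_on with
  | empty => simp
  | insert a s ha ih =>
    obtain ⟨c, hc⟩ := ih
    rw [sum_insert ha, sum_insert ha]
    exact ⟨c + f a * ∑ i ∈ s, f i, by linear_combination hc⟩

theorem natDegree_prod_erase_X_sub_C {A ι : Type*} [CommRing A] [IsDomain A] [Fintype ι]
    [DecidableEq ι] (x : ι → A) (i : ι) :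
    (∏ j ∈ univ.erase i, (X - C (x j))).natDegree = Fintype.card ι - 1 := by
  rw [natDegree_prod _ _ fun j _ => X_sub_C_ne_zero (x j)]
  simp [card_erase_of_mem, card_univ]

/-- Lagrange interpolation of `X ^ ℓ` at the pairwise distinct nodes `x i`. -/
theorem X_pow_eq_sum_C_mul_prod_erase {A ι : Type*} [CommRing A] [IsDomain A] [Fintype ι]
    [DecidableEq ι] {x : ι → A} (hx : Function.Injective x) {ℓ : ℕ} (hℓ : ℓ < Fintype.card ι)
    {γ : ι → A} (hγ : ∀ i, γ i * ∏ j ∈ univ.erase i, (x i - x j) = x i ^ ℓ) :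
    (X : A[X]) ^ ℓ = ∑ i, C (γ i) * ∏ j ∈ univ.erase i, (X - C (x j)) := by
  refine eq_of_degrees_lt_of_eval_index_eq univ (v := x) hx.injOn ?_ ?_ fun k _ => ?_
  · rw [degree_X_pow, card_univ]
    exact_mod_cast hℓ
  · refine (degree_sum_le _ _).trans_lt ((Finset.sup_lt_iff (WithBot.bot_lt_coe _)).2 ?_)
    intro i _
    refine (degree_le_natDegree.trans (Nat.cast_le.2 (natDegree_C_mul_le _ _))).trans_lt ?_
    rw [natDegree_prod_erase_X_sub_C, card_univ]
    exact_mod_cast (by omega : Fintype.card ι - 1 < Fintype.card ι)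
  · rw [eval_finsetSum, sum_eq_single k]
    · simp [eval_prod, hγ]
    · intro i _ hik
      rw [eval_mul, eval_prod, prod_eq_zero (mem_erase.2 ⟨hik.symm, mem_univ k⟩) (by simp),
        mul_zero]
    · simp

/-- Lemma 1 of the paper: if `γ_{iℓ} = X_i^ℓ · (∏_{j≠i}(X_i − X_j))⁻¹` are the
partial-fraction coefficients of `X^ℓ/Q`, then
`X^{2ℓ} − ∑_i γ_{iℓ}² Q_i(X)²` lies in `2·A[X]` and has degree at most `2r−1`,
where `Q_i(X) = Q(X)/(X−X_i) = ∏_{j≠i}(X−X_j)`. -/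
theorem lemma1 (A : Type*) [CommRing A] [IsDomain A] (r : ℕ) (hr : 1 ≤ r)
    (Xp : Fin r → A) (hX0 : ∀ i, Xp i ≠ 0)
    (hXunit : ∀ i j, i ≠ j → IsUnit (Xp i - Xp j))
    (ℓ : ℕ) (hℓ : ℓ ≤ r - 1)
    (γ : Fin r → A)
    (hγ : ∀ i, γ i * ∏ j ∈ univ.erase i, (Xp i - Xp j) = Xp i ^ ℓ) :
    (X : A[X]) ^ (2 * ℓ) -
        ∑ i, C (γ i ^ 2) * (∏ j ∈ univ.erase i, (X - C (Xp j))) ^ 2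
      ∈ Ideal.span {(2 : A[X])} ∧
    ((X : A[X]) ^ (2 * ℓ) -
        ∑ i, C (γ i ^ 2) * (∏ j ∈ univ.erase i, (X - C (Xp j))) ^ 2).natDegree ≤ 2 * r - 1 := by
  have hinj : Function.Injective Xp := fun i j hij => by
    by_contra hne
    exact (hXunit i j hne).ne_zero (sub_eq_zero.2 hij)
  constructor
  · have key := X_pow_eq_sum_C_mul_prod_erase hinj (by rw [Fintype.card_fin]; omega) hγ
    rw [Ideal.mem_span_singleton, mul_comm 2 ℓ, pow_mul, key]
    simp_rw [C_pow, ← mul_pow]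
    exact two_dvd_sq_sum_sub_sum_sq _ _
  · refine (natDegree_sub_le _ _).trans (max_le ?_ ?_)
    · rw [natDegree_X_pow]
      omega
    · refine natDegree_sum_le_of_forall_le _ _ fun i _ => (natDegree_C_mul_le _ _).trans ?_
      rw [natDegree_pow, natDegree_prod_erase_X_sub_C, Fintype.card_fin]
      omega
end

section
/- Let K be a field of characteristic 0 equipped with an additive valuation v (with values in a linearly ordered abelian group, e.g. taking v with rational values), and let R = {x ∈ K : v(x) ≥ 0} be its valuation ring. Let u_1, u_2, u_3 ∈ K be nonzero with v(u_1) ≥ v(u_2) ≥ v(u_3), v(u_1 + u_2) = v(u_2), v(u_1 + u_3) = v(u_3), v(u_2 + u_3) = v(u_3), v(u_1 + u_2 + u_3) = v(u_3), and v(u_1) ≤ v(u_2) + 2·v(u_3). Suppose c ∈ K is nonzero with c³ = u_1u_2u_3(u_1+u_2)(u_1+u_3)(u_2+u_3)(u_1+u_2+u_3), and set a_1 = u_2u_3(u_2+u_3)/c, a_2 = u_1u_3(u_1+u_3)/c, a_3 = u_1u_2(u_1+u_2)/c. Then: (i) a_1, a_2, a_3 ∈ R, with 3·v(a_1) = v(u_2)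 + 2·v(u_3) − v(u_1), 3·v(a_2) = 2·(v(u_1) − v(u_2) + v(u_3)), and 3·v(a_3) = 2·(v(u_1) + 2·v(u_2) − 2·v(u_3)); (ii) a_2²a_3²(a_2+a_3)² − u_1⁴ ∈ 4R, a_1²a_3²(a_1+a_3)² − u_2⁴ ∈ 4R, and a_1²a_2²(a_1+a_2)² − u_3⁴ ∈ 4R. -/
theorem AddValuation.map_div_eq_zero {K Γ : Type*} [Field K] [LinearOrderedAddCommGroupWithTop Γ]
    (v : AddValuation K Γ) {x y : K} (hy : y ≠ 0) (h : v x = v y) : v (x / y) = 0 := by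
  rw [v.map_div, h]
  exact LinearOrderedAddCommGroupWithTop.sub_self_eq_zero_iff_ne_top.2 (v.ne_top_iff.2 hy)

theorem AddValuation.map_div_nonneg {K Γ : Type*} [Field K] [LinearOrderedAddCommGroupWithTop Γ]
    (v : AddValuation K Γ) {x y : K} (hy : y ≠ 0) (h : v y ≤ v x) : 0 ≤ v (x / y) := by
  have hy' := v.ne_top_iff.2 hy
  rw [v.map_div, ← LinearOrderedAddCommGroupWithTop.sub_self_eq_zero_iff_ne_top.2 hy']
  exact (LinearOrderedAddCommGroupWithTop.sub_le_sub_iff_left_of_ne_top hy').2 h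

theorem nonneg_of_nsmul_three_nonneg {Γ : Type*} [LinearOrderedAddCommGroupWithTop Γ] {a : Γ}
    (h : 0 ≤ 3 • a) : 0 ≤ a := by
  by_contra! ha
  refine absurd h (not_le.2 (lt_of_le_of_lt ?_ ha))
  calc 3 • a = a + (a + a) := by rw [succ_nsmul', two_nsmul]
    _ ≤ a + 0 := by gcongr; exact add_nonpos ha.le ha.le
    _ = a := add_zero a

/-- The square of `x² - 2t` differs from `x⁴` by `4 (t² - x² t)`. -/
theorem exists_sq_sub_pow_four_eq_four_mul {K : Type*} [CommRing K] (S : Subring K) {x t b : K}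
    (hx : x ∈ S) (ht : t ∈ S) (hb : b = x ^ 2 - 2 * t) :
    ∃ w ∈ S, b ^ 2 - x ^ 4 = 4 * w :=
  ⟨t ^ 2 - x ^ 2 * t, sub_mem (pow_mem ht 2) (mul_mem (pow_mem hx 2) ht), by rw [hb]; ring⟩

/-- If `c³ = x y z (x+y)(x+z)(y+z)(x+y+z)`, then `b = (xz(x+z)/c)` and `d = (xy(x+y)/c)` satisfy
`b d (b + d) = x² - 2 x² y z / ((y+z)(x+y+z))`. -/
theorem mul_mul_add_eq_sq_sub {K : Type*} [Field K] {x y z c : K}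
    (hc : c ≠ 0) (hc3 : c ^ 3 = x * y * z * (x + y) * (x + z) * (y + z) * (x + y + z)) :
    (x * z * (x + z) / c) * (x * y * (x + y) / c) *
        (x * z * (x + z) / c + x * y * (x + y) / c) =
      x ^ 2 - 2 * (x ^ 2 * y * z / ((y + z) * (x + y + z))) := by
  have h3 : x * y * z * (x + y) * (x + z) * (y + z) * (x + y + z) ≠ 0 := hc3 ▸ pow_ne_zero 3 hc
  simp only [mul_ne_zero_iff] at h3
  obtain ⟨⟨⟨⟨⟨⟨hx, hy⟩, hz⟩, hxy⟩, hxz⟩, hyz⟩, hs⟩ := h3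
  calc _ = (x * z * (x + z)) * (x * y * (x + y)) * (x * z * (x + z) + x * y * (x + y)) / c ^ 3 := by
        field_simp
    _ = _ := by
        rw [hc3]
        field_simp
        ring

/-- Proposition 4 of the paper: given `u₁, u₂, u₃` in a valued field `K` of
characteristic `0` satisfying the stated valuation-theoretic hypotheses, and a
cube root `c` of `π₃ = u₁u₂u₃(u₁+u₂)(u₁+u₃)(u₂+u₃)(u₁+u₂+u₃)`, the elements
`a₁ = u₂u₃(u₂+u₃)/c`, `a₂ = u₁u₃(u₁+u₃)/c`, `a₃ = u₁u₂(u₁+u₂)/c` lie in the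
valuation ring `R`, have the stated valuations, and satisfy
`a₂²a₃²(a₂+a₃)² ≡ u₁⁴`, `a₁²a₃²(a₁+a₃)² ≡ u₂⁴`, `a₁²a₂²(a₁+a₂)² ≡ u₃⁴` mod `4R`. -/
theorem prop4 (K : Type*) [Field K] [CharZero K]
    (Γ : Type*) [LinearOrderedAddCommGroupWithTop Γ]
    (v : AddValuation K Γ)
    (S : Subring K) (hS : ∀ x : K, x ∈ S ↔ 0 ≤ v x)
    (u1 u2 u3 : K) (hu1 : u1 ≠ 0) (hu2 : u2 ≠ 0) (hu3 : u3 ≠ 0)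
    (h21 : v u2 ≤ v u1) (h32 : v u3 ≤ v u2)
    (hv12 : v (u1 + u2) = v u2) (hv13 : v (u1 + u3) = v u3)
    (hv23 : v (u2 + u3) = v u3) (hv123 : v (u1 + u2 + u3) = v u3)
    (hbound : v u1 ≤ v u2 + 2 • v u3)
    (c : K) (hc : c ≠ 0)
    (hc3 : c ^ 3 = u1 * u2 * u3 * (u1 + u2) * (u1 + u3) * (u2 + u3) * (u1 + u2 + u3))
    (a1 a2 a3 : K)
    (ha1 : a1 = u2 * u3 * (u2 + u3) / c)
    (ha2 : a2 = u1 * u3 * (u1 + u3) / c)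
    (ha3 : a3 = u1 * u2 * (u1 + u2) / c) :
    (a1 ∈ S ∧ a2 ∈ S ∧ a3 ∈ S) ∧
    (3 • v a1 = v u2 + 2 • v u3 - v u1 ∧
      3 • v a2 = 2 • (v u1 - v u2 + v u3) ∧
      3 • v a3 = 2 • (v u1 + 2 • v u2 - 2 • v u3)) ∧
    ((∃ w ∈ S, a2 ^ 2 * a3 ^ 2 * (a2 + a3) ^ 2 - u1 ^ 4 = 4 * w) ∧
      (∃ w ∈ S, a1 ^ 2 * a3 ^ 2 * (a1 + a3) ^ 2 - u2 ^ 4 = 4 * w) ∧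
      (∃ w ∈ S, a1 ^ 2 * a2 ^ 2 * (a1 + a2) ^ 2 - u3 ^ 4 = 4 * w)) := by
  have hp0 : u1 + u2 ≠ 0 := by rintro h; simp [h] at hc3; exact hc hc3
  have hq0 : u1 + u3 ≠ 0 := by rintro h; simp [h] at hc3; exact hc hc3
  have hr0 : u2 + u3 ≠ 0 := by rintro h; simp [h] at hc3; exact hc hc3
  have hs0 : u1 + u2 + u3 ≠ 0 := by rintro h; simp [h] at hc3; exact hc hc3
  have hp := v.map_div_eq_zero hu2 hv12
  have hq := v.map_div_eq_zero hu3 hv13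
  have hr := v.map_div_eq_zero hu3 hv23
  have hs := v.map_div_eq_zero hu3 hv123
  have hw1 : 0 ≤ v (u2 * u3 ^ 2 / u1) :=
    v.map_div_nonneg hu1 (by rwa [v.map_mul, v.map_pow])
  have h12 : u1 / u2 ∈ S := (hS _).2 (v.map_div_nonneg hu2 h21)
  have h23 : u2 / u3 ∈ S := (hS _).2 (v.map_div_nonneg hu3 h32)
  have hm3 : u3 ∈ S := by
    have h : u3 ^ 2 ∈ S := by
      have := mul_mem ((hS _).2 hw1) h12
      convert this using 1
      field_simp
    rw [hS, v.map_pow, two_nsmul] at h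
    rw [hS]
    by_contra! h0
    exact absurd h (not_le.2 (lt_of_le_of_lt (add_le_of_nonpos_right h0.le) h0))
  have hm2 : u2 ∈ S := by simpa [hu3] using mul_mem h23 hm3
  have hm1 : u1 ∈ S := by simpa [hu2] using mul_mem h12 hm2
  have hinv : ∀ x : K, v x = 0 → x⁻¹ ∈ S := fun x hx => by
    rw [hS, ← one_div, v.map_div, v.map_one, hx, sub_zero]
  have e1 : 3 • v a1 = v (u2 * u3 ^ 2 / u1) := by
    have h : a1 ^ 3 = u2 * u3 ^ 2 / u1 * (((u2 + u3) / u3) ^ 2 /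
        ((u1 + u2) / u2 * ((u1 + u3) / u3) * ((u1 + u2 + u3) / u3))) := by
      rw [ha1, div_pow, hc3]; field_simp
    rw [← v.map_pow, h, v.map_mul, v.map_div (x := ((u2 + u3) / u3) ^ 2)]
    simp only [v.map_mul, v.map_pow, hp, hq, hr, hs, smul_zero, add_zero, sub_zero]
  have e2 : 3 • v a2 = v ((u1 / u2 * u3) ^ 2) := by
    have h : a2 ^ 3 = (u1 / u2 * u3) ^ 2 * (((u1 + u3) / u3) ^ 2 /
        ((u1 + u2) / u2 * ((u2 + u3) / u3) * ((u1 + u2 + u3) / u3))) := by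
      rw [ha2, div_pow, hc3]; field_simp
    rw [← v.map_pow, h, v.map_mul, v.map_div (x := ((u1 + u3) / u3) ^ 2)]
    simp only [v.map_mul, v.map_pow, hp, hq, hr, hs, smul_zero, add_zero, sub_zero]
  have e3 : 3 • v a3 = v ((u1 * u2 ^ 2 / u3 ^ 2) ^ 2) := by
    have h : a3 ^ 3 = (u1 * u2 ^ 2 / u3 ^ 2) ^ 2 * (((u1 + u2) / u2) ^ 2 /
        ((u1 + u3) / u3 * ((u2 + u3) / u3) * ((u1 + u2 + u3) / u3))) := by
      rw [ha3, div_pow, hc3]; field_simp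
    rw [← v.map_pow, h, v.map_mul, v.map_div (x := ((u1 + u2) / u2) ^ 2)]
    simp only [v.map_mul, v.map_pow, hp, hq, hr, hs, smul_zero, add_zero, sub_zero]
  refine ⟨⟨?_, ?_, ?_⟩, ⟨?_, ?_, ?_⟩, ?_, ?_, ?_⟩
  · exact (hS _).2 (nonneg_of_nsmul_three_nonneg (e1 ▸ hw1))
  · exact (hS _).2 (nonneg_of_nsmul_three_nonneg
      (e2 ▸ (hS _).1 (pow_mem (mul_mem h12 hm3) 2)))
  · refine (hS _).2 (nonneg_of_nsmul_three_nonneg (e3 ▸ (hS _).1 (pow_mem ?_ 2)))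
    convert mul_mem hm1 (pow_mem h23 2) using 1
    field_simp
  · rw [e1, v.map_div, v.map_mul, v.map_pow]
  · rw [e2, v.map_pow, v.map_mul, v.map_div]
  · rw [e3, v.map_pow, v.map_div, v.map_mul, v.map_pow, v.map_pow]
  · have ht : u1 ^ 2 * u2 * u3 / ((u2 + u3) * (u1 + u2 + u3)) ∈ S := by
      convert mul_mem (mul_mem (mul_mem (pow_mem hm1 2) h23) (hinv _ hr)) (hinv _ hs) using 1
      field_simp
    rw [← mul_pow, ← mul_pow]
    refine exists_sq_sub_pow_four_eq_four_mul S hm1 ht ?_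
    rw [ha2, ha3]
    exact mul_mul_add_eq_sq_sub hc hc3
  · have ht : u2 ^ 2 * u1 * u3 / ((u1 + u3) * (u2 + u1 + u3)) ∈ S := by
      convert mul_mem (mul_mem (mul_mem (mul_mem hm2 hm1) h23) (hinv _ hq)) (hinv _ hs) using 1
      rw [add_comm u2 u1]
      field_simp
    rw [← mul_pow, ← mul_pow]
    refine exists_sq_sub_pow_four_eq_four_mul S hm2 ht ?_
    rw [ha1, ha3, ← mul_mul_add_eq_sq_sub hc (by rw [hc3]; ring)]
    ring
  · have ht : u3 ^ 2 * u1 * u2 / ((u1 + u2) * (u3 + u1 + u2)) ∈ S := by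
      convert mul_mem (mul_mem (mul_mem hm3 hm1) (hinv _ hp)) (hinv _ hs) using 1
      rw [show u3 + u1 + u2 = u1 + u2 + u3 by ring]
      field_simp
    rw [← mul_pow, ← mul_pow]
    refine exists_sq_sub_pow_four_eq_four_mul S hm3 ht ?_
    rw [ha1, ha2, ← mul_mul_add_eq_sq_sub hc (by rw [hc3]; ring)]
    ring
end

section
/- Let R be a commutative ring, and let X_0, a, b, β ∈ R be such that β·(a² + b²) ∈ 4R and β·a²·b² ∈ 4R. Then the polynomial (X − X_0)·(X − X_0 + a²)·(X − X_0 + b²)·(X − X_0 + (a+b)² + β) − [ ( (X − X_0)² + (a² + b² + ab)(X − X_0) )² + a²b²(a+b)²·(X − X_0) + β·(X − X_0)³ ] lies in the ideal 4·R[X] and has degree at most 2. -/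
open Polynomial

/-- The exact difference between the quartic with perturbed fourth root and its approximation. -/
theorem perturbed_quartic_sub_eq {R : Type*} [CommRing R] (X0 a b β : R) :
    (X - C X0) * (X - C X0 + C (a ^ 2)) * (X - C X0 + C (b ^ 2)) *
          (X - C X0 + C ((a + b) ^ 2 + β)) -
        (((X - C X0) ^ 2 + C (a ^ 2 + b ^ 2 + a * b) * (X - C X0)) ^ 2 +
          C (a ^ 2 * b ^ 2 * (a + b) ^ 2) * (X - C X0) + C β * (X - C X0) ^ 3) =
      C (β * (a ^ 2 + b ^ 2)) * (X - C X0) ^ 2 + C (β * a ^ 2 * b ^ 2) * (X - C X0) := by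
  simp only [C_add, C_mul, C_pow]
  ring

/-- The congruence used in Section V.7 of the paper: perturbing the fourth root
`(a+b)²` of the quartic `(X−X₀)(X−X₀+a²)(X−X₀+b²)(X−X₀+(a+b)²)` by an element `β`
with `β(a²+b²) ∈ 4R` and `βa²b² ∈ 4R` changes the quartic, modulo `4R[X]`, only by
the extra term `β(X−X₀)³`. -/
theorem perturbed_quartic_congruence (R : Type*) [CommRing R] (X0 a b β : R)
    (h1 : (4 : R) ∣ β * (a ^ 2 + b ^ 2)) (h2 : (4 : R) ∣ β * a ^ 2 * b ^ 2) :
    (X - C X0) * (X - C X0 + C (a ^ 2)) * (X - C X0 + C (b ^ 2)) *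
          (X - C X0 + C ((a + b) ^ 2 + β)) -
        (((X - C X0) ^ 2 + C (a ^ 2 + b ^ 2 + a * b) * (X - C X0)) ^ 2 +
          C (a ^ 2 * b ^ 2 * (a + b) ^ 2) * (X - C X0) + C β * (X - C X0) ^ 3)
      ∈ Ideal.span {(4 : R[X])} ∧
    ((X - C X0) * (X - C X0 + C (a ^ 2)) * (X - C X0 + C (b ^ 2)) *
          (X - C X0 + C ((a + b) ^ 2 + β)) -
        (((X - C X0) ^ 2 + C (a ^ 2 + b ^ 2 + a * b) * (X - C X0)) ^ 2 +
          C (a ^ 2 * b ^ 2 * (a + b) ^ 2) * (X - C X0) + C β * (X - C X0) ^ 3)).natDegree ≤ 2 := by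
  rw [perturbed_quartic_sub_eq]
  constructor
  · have hC : ∀ {r : R}, (4 : R) ∣ r → (4 : R[X]) ∣ C r := fun h => by
      simpa only [map_ofNat] using map_dvd (C : R →+* R[X]) h
    rw [Ideal.mem_span_singleton]
    exact dvd_add ((hC h1).mul_right _) ((hC h2).mul_right _)
  · compute_degree
end
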